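/- arXiv:1902.10292 — 3 statements merged into one kernel-verified Lean document; each statement's English description precedes it below -/
import Mathlib

section
/- (Key inequality in the proof of Lemma 2) Let {S_1, …, S_M} be a solution set of the AAO coupled Riccati equations on an interval I = [t_f − δ, t_f] ⊆ [t_0, t_f] with 0 < δ ≤ t_f − t_0. Let Q : [t_0, t_f] → ℝ^{n×n} be a continuous bounded symmetric matrix function such that ℛ_Q is positivity-preserving, and let L_Q be the associated comparison solution. Then for all t ∈ I, 0 ≺ −S_1(t) + Σ_{i=2}^M S_i(t) ⪯ L_Q(t). -/
open Matrix Set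

/-- The map `ℛ_Q` of the AAO game.  Players are indexed by `Fin M`, index `0`
being player 1 (the opposing player). -/
def RQmap {n M : ℕ} [NeZero M] (H : Fin M → ℝ → Matrix (Fin n) (Fin n) ℝ)
    (Qc : ℝ → Matrix (Fin n) (Fin n) ℝ) (W : Fin M → Matrix (Fin n) (Fin n) ℝ)
    (t : ℝ) : Matrix (Fin n) (Fin n) ℝ :=
  Qc t + W 0 * H 0 t * W 0 - ∑ i ∈ Finset.univ.erase 0, W i * H i t * W i
    + (-(W 0) + ∑ i ∈ Finset.univ.erase 0, W i) * (∑ j, H j t * W j)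
    + (∑ j, W j * H j t) * (-(W 0) + ∑ i ∈ Finset.univ.erase 0, W i)

section Lyapunov

variable {ι : Type*} [Fintype ι]

theorem hasDerivWithinAt_quadForm {X : ℝ → Matrix ι ι ℝ} {X' : Matrix ι ι ℝ} {s : Set ℝ} {t : ℝ}
    (hX : ∀ k l, HasDerivWithinAt (fun r => X r k l) (X' k l) s t) (v : ι → ℝ) :
    HasDerivWithinAt (fun r => v ⬝ᵥ X r *ᵥ v) (v ⬝ᵥ X' *ᵥ v) s t := by
  simp only [dotProduct, mulVec]
  exact HasDerivWithinAt.fun_sum fun k _ =>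
    (HasDerivWithinAt.fun_sum fun l _ => (hX k l).mul_const (v l)).const_mul (v k)


/-- A symmetric strict supersolution of the backward Lyapunov equation which is positive definite
at the final time is positive definite at all earlier times. -/
theorem posDef_of_lyapunov {a b : ℝ} {X X' F : ℝ → Matrix ι ι ℝ}
    (hsym : ∀ t ∈ Icc a b, (X t).IsSymm)
    (hX : ∀ t ∈ Icc a b, ∀ k l, HasDerivWithinAt (fun s => X s k l) (X' t k l) (Icc a b) t)
    (hb : (X b).PosDef)
    (hlt : ∀ t ∈ Icc a b, (-(X' t + X t * F t + (F t)ᵀ * X t)).PosDef) :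
    ∀ t ∈ Icc a b, (X t).PosDef := by
  set q : ℝ × (ι → ℝ) → ℝ := fun p => p.2 ⬝ᵥ X p.1 *ᵥ p.2 with hq
  set K : Set (ℝ × (ι → ℝ)) := Icc a b ×ˢ Metric.sphere 0 1 with hK
  have hKc : IsCompact K := isCompact_Icc.prod (isCompact_sphere _ _)
  have hqc : ContinuousOn q K := by
    simp only [hq, dotProduct, mulVec]
    have hXc : ∀ k l, ContinuousOn (fun p : ℝ × (ι → ℝ) => X p.1 k l) K := fun k l =>
      ContinuousOn.comp (g := fun t => X t k l) (fun t ht => (hX t ht k l).continuousWithinAt)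
        continuousOn_fst fun p hp => hp.1
    have hvc : ∀ k, ContinuousOn (fun p : ℝ × (ι → ℝ) => p.2 k) K := fun k => by fun_prop
    exact continuousOn_finsetSum _ fun k _ => (hvc k).mul
      (continuousOn_finsetSum _ fun l _ => (hXc k l).mul (hvc l))
  have hBc : IsCompact (K ∩ q ⁻¹' Iic 0) :=
    hKc.of_isClosed_subset (hqc.preimage_isClosed_of_isClosed hKc.isClosed isClosed_Iic)
      inter_subset_left
  have pos_of {t : ℝ} (ht : t ∈ Icc a b) (h : ∀ u, (t, u) ∉ K ∩ q ⁻¹' Iic 0) (v : ι → ℝ)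
      (hv : v ≠ 0) : 0 < v ⬝ᵥ X t *ᵥ v := by
    have hn : 0 < ‖v‖ := norm_pos_iff.2 hv
    have h1 : 0 < q (t, ‖v‖⁻¹ • v) := by
      by_contra hcon
      refine h (‖v‖⁻¹ • v) ⟨⟨ht, ?_⟩, not_lt.1 hcon⟩
      simp [norm_smul, hn.ne']
    simp only [hq, mulVec_smul, dotProduct_smul, smul_dotProduct, smul_eq_mul] at h1
    exact pos_of_mul_pos_right (pos_of_mul_pos_right h1 (by positivity)) (by positivity)
  rcases (K ∩ q ⁻¹' Iic 0).eq_empty_or_nonempty with hemp | hne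
  · exact fun t ht => .of_dotProduct_mulVec_pos (isHermitian_iff_isSymm.2 (hsym t ht))
      fun v hv => pos_of ht (by simp [hemp]) v hv
  exfalso
  obtain ⟨⟨τ, v⟩, ⟨⟨hτ, hv⟩, hqv⟩, hmax⟩ := hBc.exists_isMaxOn hne continuousOn_fst
  replace hτ : τ ∈ Icc a b := hτ
  replace hqv : v ⬝ᵥ X τ *ᵥ v ≤ 0 := hqv
  have hv0 : v ≠ 0 := by rintro rfl; simp at hv
  have hτb : τ < b := by
    refine lt_of_le_of_ne hτ.2 ?_
    rintro rfl
    exact hqv.not_gt (hb.dotProduct_mulVec_pos hv0)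
  have hsub : Ioc τ b ⊆ Icc a b := fun s hs => ⟨hτ.1.trans hs.1.le, hs.2⟩
  have hpos : ∀ s ∈ Ioc τ b, ∀ u : ι → ℝ, u ≠ 0 → 0 < u ⬝ᵥ X s *ᵥ u := fun s hs u hu =>
    pos_of (hsub hs) (fun w hw => (hmax hw).not_gt hs.1) u hu
  have hderiv : ∀ u : ι → ℝ,
      HasDerivWithinAt (fun s => u ⬝ᵥ X s *ᵥ u) (u ⬝ᵥ X' τ *ᵥ u) (Ioc τ b) τ :=
    fun u => (hasDerivWithinAt_quadForm (hX τ hτ) u).mono hsub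
  have : (nhdsWithin τ (Ioc τ b)).NeBot := by
    rw [nhdsWithin_Ioc_eq_nhdsGT hτb]; infer_instance
  have hpsd : (X τ).PosSemidef := by
    refine .of_dotProduct_mulVec_nonneg (isHermitian_iff_isSymm.2 (hsym τ hτ)) fun u => ?_
    rcases eq_or_ne u 0 with rfl | hu
    · simp
    exact ge_of_tendsto (hderiv u).continuousWithinAt
      (eventually_nhdsWithin_of_forall fun s hs => (hpos s hs u hu).le)
  have hqv0 : v ⬝ᵥ X τ *ᵥ v = 0 := hqv.antisymm (hpsd.dotProduct_mulVec_nonneg v)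
  have hXv : X τ *ᵥ v = 0 := (hpsd.dotProduct_mulVec_zero_iff v).1 hqv0
  have hge : 0 ≤ v ⬝ᵥ X' τ *ᵥ v := by
    refine ge_of_tendsto ((hasDerivWithinAt_iff_tendsto_slope' (by simp)).1 (hderiv v))
      (eventually_nhdsWithin_of_forall fun s hs => ?_)
    rw [slope_def_field, hqv0, sub_zero]
    exact div_nonneg (hpos s hs v hv0).le (sub_nonneg.2 hs.1.le)
  have hlt' := (hlt τ hτ).dotProduct_mulVec_pos hv0
  have hvX : v ᵥ* X τ = 0 := by rw [← mulVec_transpose, (hsym τ hτ).eq, hXv]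
  simp only [star_trivial, neg_mulVec, add_mulVec, dotProduct_neg, dotProduct_add,
    ← mulVec_mulVec, hXv, mulVec_zero, dotProduct_mulVec _ (X τ), hvX,
    zero_dotProduct, add_zero] at hlt'
  linarith

theorem exists_quadForm_le {a b : ℝ} {F : ℝ → Matrix ι ι ℝ}
    (hF : ∀ k l, ContinuousOn (fun t => F t k l) (Icc a b)) :
    ∃ C, ∀ t ∈ Icc a b, ∀ v : ι → ℝ, v ⬝ᵥ F t *ᵥ v ≤ C * (v ⬝ᵥ v) := by
  obtain ⟨C, hC⟩ := isCompact_Icc.exists_bound_of_continuousOn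
    (continuousOn_finsetSum Finset.univ fun k _ =>
      continuousOn_finsetSum Finset.univ fun l _ => (hF k l).abs)
  refine ⟨C, fun t ht v => ?_⟩
  have hsq : ∀ k, v k ^ 2 ≤ v ⬝ᵥ v := fun k => by
    rw [pow_two]
    exact Finset.single_le_sum (f := fun k => v k * v k) (fun _ _ => mul_self_nonneg _)
      (Finset.mem_univ k)
  have hvv : 0 ≤ v ⬝ᵥ v := Finset.sum_nonneg fun _ _ => mul_self_nonneg _
  calc v ⬝ᵥ F t *ᵥ v = ∑ k, ∑ l, v k * (F t k l * v l) := by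
        simp only [dotProduct, mulVec, Finset.mul_sum]
    _ ≤ ∑ k, ∑ l, |F t k l| * (v ⬝ᵥ v) := by
        refine Finset.sum_le_sum fun k _ => Finset.sum_le_sum fun l _ => ?_
        have h1 : |v k * v l| ≤ v ⬝ᵥ v := by
          rw [abs_le]
          constructor <;> nlinarith [hsq k, hsq l, sq_nonneg (v k + v l), sq_nonneg (v k - v l)]
        calc v k * (F t k l * v l) ≤ |v k * (F t k l * v l)| := le_abs_self _
          _ = |F t k l| * |v k * v l| := by rw [← abs_mul]; ring_nf
          _ ≤ _ := by gcongr
    _ = (∑ k, ∑ l, |F t k l|) * (v ⬝ᵥ v) := by simp only [Finset.sum_mul]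
    _ ≤ C * (v ⬝ᵥ v) := by
        gcongr
        exact (le_abs_self _).trans (hC t ht)

/-- A symmetric supersolution of the backward Lyapunov equation which is positive semidefinite
at the final time is positive semidefinite at all earlier times. -/
theorem posSemidef_of_lyapunov {a b : ℝ} {X X' F : ℝ → Matrix ι ι ℝ}
    (hF : ∀ k l, ContinuousOn (fun t => F t k l) (Icc a b))
    (hsym : ∀ t ∈ Icc a b, (X t).IsSymm)
    (hX : ∀ t ∈ Icc a b, ∀ k l, HasDerivWithinAt (fun s => X s k l) (X' t k l) (Icc a b) t)
    (hb : (X b).PosSemidef)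
    (hle : ∀ t ∈ Icc a b, (-(X' t + X t * F t + (F t)ᵀ * X t)).PosSemidef) :
    ∀ t ∈ Icc a b, (X t).PosSemidef := by
  classical
  obtain ⟨C, hC⟩ := exists_quadForm_le hF
  set c := 2 * C + 1 with hc
  have hpert (ε : ℝ) (hε : 0 < ε) : ∀ t ∈ Icc a b,
      (X t + (ε * Real.exp (-c * t)) • (1 : Matrix ι ι ℝ)).PosDef := by
    refine posDef_of_lyapunov (F := F)
      (X' := fun t => X' t + (ε * (Real.exp (-c * t) * -c)) • (1 : Matrix ι ι ℝ)) ?_ ?_ ?_ ?_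
    · exact fun t ht => (hsym t ht).add (isSymm_one.smul _)
    · intro t ht k l
      have he : HasDerivAt (fun s => ε * Real.exp (-c * s)) (ε * (Real.exp (-c * t) * -c)) t := by
        simpa using (((hasDerivAt_id t).const_mul (-c)).exp.const_mul ε)
      simpa using (hX t ht k l).fun_add (he.hasDerivWithinAt.mul_const ((1 : Matrix ι ι ℝ) k l))
    · exact PosDef.posSemidef_add hb (PosDef.one.smul (by positivity))
    · intro t ht
      have hrest : ((ε * Real.exp (-c * t)) • (c • 1 - F t - (F t)ᵀ)).PosDef := by
        refine PosDef.smul (.of_dotProduct_mulVec_pos ?_ fun v hv => ?_) (by positivity)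
        · rw [isHermitian_iff_isSymm, IsSymm]
          simp only [transpose_sub, transpose_smul, transpose_one, transpose_transpose]
          abel
        · have hvv : 0 < v ⬝ᵥ v := by simpa using dotProduct_star_self_pos_iff.2 hv
          have hT : v ⬝ᵥ (F t)ᵀ *ᵥ v = v ⬝ᵥ F t *ᵥ v := by
            rw [mulVec_transpose, dotProduct_comm, dotProduct_mulVec]
          simp only [star_trivial, sub_mulVec, smul_mulVec, one_mulVec, dotProduct_sub,
            dotProduct_smul, smul_eq_mul, hT]
          nlinarith [hC t ht v]
      convert PosDef.posSemidef_add (hle t ht) hrest using 1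
      simp only [add_mul, mul_add, smul_mul_assoc, mul_smul_comm, one_mul, mul_one]
      module
  intro t ht
  refine .of_dotProduct_mulVec_nonneg (isHermitian_iff_isSymm.2 (hsym t ht)) fun v => ?_
  have hlim : Filter.Tendsto
      (fun ε : ℝ => v ⬝ᵥ X t *ᵥ v + ε * (Real.exp (-c * t) * (v ⬝ᵥ v)))
      (nhdsWithin 0 (Ioi 0)) (nhds (v ⬝ᵥ X t *ᵥ v)) := by
    have : Continuous fun ε : ℝ => v ⬝ᵥ X t *ᵥ v + ε * (Real.exp (-c * t) * (v ⬝ᵥ v)) := by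
      fun_prop
    simpa using (this.tendsto 0).mono_left nhdsWithin_le_nhds
  refine ge_of_tendsto hlim (eventually_nhdsWithin_of_forall fun ε hε => ?_)
  have := (hpert ε hε t ht).posSemidef.dotProduct_mulVec_nonneg v
  simpa [add_mulVec, smul_mulVec, mul_assoc] using this

/-- The homogeneous backward Lyapunov equation with zero final value has only the zero solution. -/
theorem eq_zero_of_lyapunov {a b : ℝ} {Z Z' F : ℝ → Matrix ι ι ℝ}
    (hF : ∀ k l, ContinuousOn (fun t => F t k l) (Icc a b))
    (hZ : ∀ t ∈ Icc a b, ∀ k l, HasDerivWithinAt (fun s => Z s k l) (Z' t k l) (Icc a b) t)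
    (hb : Z b = 0)
    (heq : ∀ t ∈ Icc a b, Z' t + Z t * F t + (F t)ᵀ * Z t = 0) :
    ∀ t ∈ Icc a b, Z t = 0 := by
  have hW := posSemidef_of_lyapunov (a := a) (b := b)
    (X := fun t => fromBlocks 0 (Z t) (Z t)ᵀ 0) (X' := fun t => fromBlocks 0 (Z' t) (Z' t)ᵀ 0)
    (F := fun t => fromBlocks (F t) 0 0 (F t)) ?_ ?_ ?_ ?_ ?_
  · intro t ht
    refine ext_iff_mulVec.2 fun v => ?_
    have h := (hW t ht).dotProduct_mulVec_nonneg (Sum.elim (-(Z t *ᵥ v)) v)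
    have hT : v ⬝ᵥ (Z t)ᵀ *ᵥ (Z t *ᵥ v) = (Z t *ᵥ v) ⬝ᵥ (Z t *ᵥ v) := by
      rw [mulVec_transpose, dotProduct_comm, dotProduct_mulVec]
    simp only [star_trivial, fromBlocks_mulVec, Sum.elim_comp_inl, Sum.elim_comp_inr,
      zero_mulVec, neg_zero, zero_add, add_zero, sumElim_dotProduct_sumElim, mulVec_neg, neg_dotProduct,
      dotProduct_neg, hT] at h
    have h0 : 0 ≤ (Z t *ᵥ v) ⬝ᵥ (Z t *ᵥ v) := Finset.sum_nonneg fun _ _ => mul_self_nonneg _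
    rw [zero_mulVec, ← dotProduct_self_eq_zero]
    linarith
  · rintro (k | k) (l | l)
    · exact hF k l
    · exact continuousOn_const
    · exact continuousOn_const
    · exact hF k l
  · intro t _
    simp [IsSymm, fromBlocks_transpose]
  · rintro t ht (k | k) (l | l)
    · exact hasDerivWithinAt_const ..
    · exact hZ t ht k l
    · exact hZ t ht l k
    · exact hasDerivWithinAt_const ..
  · simp [hb, PosSemidef.zero]
  · intro t ht
    have hT := congrArg transpose (heq t ht)
    simp only [transpose_add, transpose_mul, transpose_transpose, transpose_zero] at hT
    have hT' : (Z' t)ᵀ + (Z t)ᵀ * F t + (F t)ᵀ * (Z t)ᵀ = 0 := by rw [← hT]; abel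
    simp [fromBlocks_transpose, fromBlocks_multiply, fromBlocks_add, heq t ht, hT',
      PosSemidef.zero]

end Lyapunov

/-- **Key inequality in the proof of Lemma 2.**  If `{S i}` is a solution set of
the AAO coupled Riccati equations on `I = [t_f − δ, t_f]`, `ℛ_Q` is
positivity-preserving and `L_Q` is the associated comparison solution, then
`0 ≺ −S_1(t) + Σ_{i≥2} S_i(t) ⪯ L_Q(t)` for all `t ∈ I`. -/
theorem aao_key_inequality {n M : ℕ} [NeZero M] (hn : 1 ≤ n) (hM : 2 ≤ M)
    {t0 tf : ℝ} (ht : t0 < tf)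
    (A : ℝ → Matrix (Fin n) (Fin n) ℝ)
    (H Q : Fin M → ℝ → Matrix (Fin n) (Fin n) ℝ)
    (Sf : Fin M → Matrix (Fin n) (Fin n) ℝ)
    (hAcont : ∀ k l, ContinuousOn (fun t => A t k l) (Icc t0 tf))
    (hHcont : ∀ i k l, ContinuousOn (fun t => H i t k l) (Icc t0 tf))
    (hQcont : ∀ i k l, ContinuousOn (fun t => Q i t k l) (Icc t0 tf))
    (hHpsd : ∀ i, ∀ t ∈ Icc t0 tf, (H i t).PosSemidef)
    (hQ1 : ∀ t ∈ Icc t0 tf, (-(Q 0 t)).PosDef)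
    (hQi : ∀ i : Fin M, i ≠ 0 → ∀ t ∈ Icc t0 tf, (Q i t).PosSemidef)
    (hSf1 : (-(Sf 0)).PosDef)
    (hSfi : ∀ i : Fin M, i ≠ 0 → (Sf i).PosSemidef)
    -- the solution set on I = [t_f − δ, t_f]
    {δ : ℝ} (hδ0 : 0 < δ) (hδ : δ ≤ tf - t0)
    (S S' : Fin M → ℝ → Matrix (Fin n) (Fin n) ℝ)
    (hSsym : ∀ i, ∀ t ∈ Icc (tf - δ) tf, (S i t).IsSymm)
    (hSderiv : ∀ i, ∀ t ∈ Icc (tf - δ) tf, ∀ k l,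
      HasDerivWithinAt (fun s => S i s k l) (S' i t k l) (Icc (tf - δ) tf) t)
    (hS'cont : ∀ i k l, ContinuousOn (fun t => S' i t k l) (Icc (tf - δ) tf))
    (hRic : ∀ i, ∀ t ∈ Icc (tf - δ) tf,
      S' i t + S i t * A t + (A t)ᵀ * S i t + Q i t + S i t * H i t * S i t
        - ∑ j, (S i t * H j t * S j t + S j t * H j t * S i t) = 0)
    (hterm : ∀ i, S i tf = Sf i)
    -- the comparison data: Q continuous bounded symmetric with ℛ_Q positivity-preserving
    (Qc : ℝ → Matrix (Fin n) (Fin n) ℝ)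
    (hQccont : ∀ k l, ContinuousOn (fun t => Qc t k l) (Icc t0 tf))
    (hQcsym : ∀ t ∈ Icc t0 tf, (Qc t).IsSymm)
    (hRQpos : ∀ W : Fin M → Matrix (Fin n) (Fin n) ℝ,
      (-(W 0)).PosSemidef → (∀ i : Fin M, i ≠ 0 → (W i).PosSemidef) →
      ∀ t ∈ Icc t0 tf, (RQmap H Qc W t).PosSemidef)
    -- the comparison solution L_Q
    (LQ LQ' : ℝ → Matrix (Fin n) (Fin n) ℝ)
    (hLQderiv : ∀ t ∈ Icc t0 tf, ∀ k l,
      HasDerivWithinAt (fun s => LQ s k l) (LQ' t k l) (Icc t0 tf) t)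
    (hLQeq : ∀ t ∈ Icc t0 tf,
      LQ' t = -(LQ t * A t) - (A t)ᵀ * LQ t
        - (Qc t - Q 0 t + ∑ i ∈ Finset.univ.erase 0, Q i t))
    (hLQf : LQ tf = -(Sf 0) + ∑ i ∈ Finset.univ.erase 0, Sf i) :
    ∀ t ∈ Icc (tf - δ) tf,
      (-(S 0 t) + ∑ i ∈ Finset.univ.erase 0, S i t).PosDef ∧
      (LQ t - (-(S 0 t) + ∑ i ∈ Finset.univ.erase 0, S i t)).PosSemidef := by
  have hsub : Icc (tf - δ) tf ⊆ Icc t0 tf := Icc_subset_Icc_left (by linarith)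
  have htf : tf ∈ Icc (tf - δ) tf := ⟨by linarith, le_rfl⟩
  have hHsym : ∀ i, ∀ t ∈ Icc (tf - δ) tf, (H i t)ᵀ = H i t := fun i t h =>
    isHermitian_iff_isSymm.1 (hHpsd i t (hsub h)).isHermitian
  have hAcont' : ∀ k l, ContinuousOn (fun t => A t k l) (Icc (tf - δ) tf) :=
    fun k l => (hAcont k l).mono hsub
  have hHcont' : ∀ i k l, ContinuousOn (fun t => H i t k l) (Icc (tf - δ) tf) :=
    fun i k l => (hHcont i k l).mono hsub
  have hScont : ∀ i k l, ContinuousOn (fun t => S i t k l) (Icc (tf - δ) tf) :=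
    fun i k l t h => (hSderiv i t h k l).continuousWithinAt
  -- each Riccati equation is a Lyapunov equation for the closed-loop matrix `F i`
  let F : Fin M → ℝ → Matrix (Fin n) (Fin n) ℝ := fun i t =>
    A t - ∑ j, H j t * S j t + (1 / 2 : ℝ) • (H i t * S i t)
  have hFcont : ∀ i k l, ContinuousOn (fun t => F i t k l) (Icc (tf - δ) tf) := by
    intro i k l
    have hHS : ∀ j, ContinuousOn (fun t => (H j t * S j t) k l) (Icc (tf - δ) tf) := fun j => by
      simp only [mul_apply]
      exact continuousOn_finsetSum _ fun m _ => (hHcont' j k m).mul (hScont j m l)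
    simp only [F, Matrix.add_apply, Matrix.sub_apply, Matrix.sum_apply, Matrix.smul_apply]
    exact ((hAcont' k l).sub (continuousOn_finsetSum _ fun j _ => hHS j)).add
      ((hHS i).const_smul (1 / 2 : ℝ))
  have hLyap : ∀ i, ∀ t ∈ Icc (tf - δ) tf,
      S' i t + S i t * F i t + (F i t)ᵀ * S i t = -Q i t := by
    intro i t h
    have hS : ∀ j, (S j t)ᵀ = S j t := fun j => hSsym j t h
    have hR := hRic i t h
    simp only [F, transpose_add, transpose_sub, transpose_smul, transpose_sum, transpose_mul,
      hS, fun j => hHsym j t h, mul_add, mul_sub, add_mul, sub_mul, Finset.mul_sum,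
      Finset.sum_mul, mul_smul_comm, smul_mul_assoc, Finset.sum_add_distrib, ← mul_assoc] at hR ⊢
    rw [← sub_eq_zero, ← hR]
    module
  have hS0 : ∀ t ∈ Icc (tf - δ) tf, (-(S 0 t)).PosDef := by
    refine posDef_of_lyapunov (F := F 0) (X' := fun t => -(S' 0 t)) (fun t h => (hSsym 0 t h).neg)
      (fun t h k l => (hSderiv 0 t h k l).neg) (by rwa [hterm]) fun t h => ?_
    convert hQ1 t (hsub h) using 1
    rw [← hLyap 0 t h]
    simp only [neg_mul, mul_neg]
    abel
  have hSi : ∀ i : Fin M, i ≠ 0 → ∀ t ∈ Icc (tf - δ) tf, (S i t).PosSemidef := by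
    intro i hi
    refine posSemidef_of_lyapunov (hFcont i) (hSsym i) (hSderiv i) (by simpa [hterm] using hSfi i hi)
      fun t h => ?_
    rw [hLyap i t h, neg_neg]
    exact hQi i hi t (hsub h)
  set P : ℝ → Matrix (Fin n) (Fin n) ℝ := fun t => -(S 0 t) + ∑ i ∈ Finset.univ.erase 0, S i t
    with hP
  set P' : ℝ → Matrix (Fin n) (Fin n) ℝ :=
    fun t => -(S' 0 t) + ∑ i ∈ Finset.univ.erase 0, S' i t with hP'
  have hPderiv : ∀ t ∈ Icc (tf - δ) tf, ∀ k l,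
      HasDerivWithinAt (fun s => P s k l) (P' t k l) (Icc (tf - δ) tf) t := by
    intro t h k l
    simp only [hP, hP', Matrix.add_apply, Matrix.neg_apply, Matrix.sum_apply]
    exact (hSderiv 0 t h k l).fun_neg.fun_add (.fun_sum fun i _ => hSderiv i t h k l)
  have hPpos : ∀ t ∈ Icc (tf - δ) tf, (P t).PosDef := fun t h =>
    (hS0 t h).add_posSemidef (posSemidef_sum _ fun i hi => hSi i (Finset.ne_of_mem_erase hi) t h)
  have hRpos : ∀ t ∈ Icc (tf - δ) tf, (RQmap H Qc (fun i => S i t) t).PosSemidef := fun t h =>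
    hRQpos _ (hS0 t h).posSemidef (fun i hi => hSi i hi t h) t (hsub h)
  have hYderiv : ∀ t ∈ Icc (tf - δ) tf, ∀ k l,
      HasDerivWithinAt (fun s => (LQ s - P s) k l) ((LQ' t - P' t) k l) (Icc (tf - δ) tf) t :=
    fun t h k l => ((hLQderiv t (hsub h) k l).mono hsub).fun_sub (hPderiv t h k l)
  have hYeq : ∀ t ∈ Icc (tf - δ) tf,
      (LQ' t - P' t) + (LQ t - P t) * A t + (A t)ᵀ * (LQ t - P t)
        = -RQmap H Qc (fun i => S i t) t := by
    intro t h
    have hS' : ∀ i, S' i t = -(S i t * A t) - (A t)ᵀ * S i t - Q i t - S i t * H i t * S i t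
        + (S i t * ∑ j, H j t * S j t + (∑ j, S j t * H j t) * S i t) := by
      intro i
      have hR := hRic i t h
      simp only [Finset.mul_sum, Finset.sum_mul, Finset.sum_add_distrib, ← mul_assoc] at hR ⊢
      rw [← sub_eq_zero, ← hR]
      abel
    rw [hLQeq t (hsub h)]
    simp only [hP, hP', RQmap, hS', Finset.sum_add_distrib, Finset.sum_sub_distrib,
      Finset.sum_neg_distrib, ← Finset.sum_mul, ← Finset.mul_sum, add_mul, mul_add, sub_mul,
      mul_sub, neg_mul, mul_neg]
    abel
  have hYtf : LQ tf - P tf = 0 := by simp [hP, hLQf, hterm]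
  have hYsymm : ∀ t ∈ Icc (tf - δ) tf, (LQ t - P t).IsSymm := by
    intro t h
    refine sub_eq_zero.1 (eq_zero_of_lyapunov (Z := fun s => (LQ s - P s)ᵀ - (LQ s - P s))
      (Z' := fun s => (LQ' s - P' s)ᵀ - (LQ' s - P' s)) hAcont'
      (fun s hs k l => (hYderiv s hs l k).fun_sub (hYderiv s hs k l)) (by simp [hYtf]) ?_ t h)
    intro s hs
    have hR : (RQmap H Qc (fun i => S i s) s)ᵀ = RQmap H Qc (fun i => S i s) s :=
      isHermitian_iff_isSymm.1 (hRpos s hs).isHermitian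
    have hT := congrArg transpose (hYeq s hs)
    rw [transpose_neg, hR, ← hYeq s hs, ← sub_eq_zero] at hT
    rw [← hT]
    generalize LQ s - P s = Y
    generalize LQ' s - P' s = Y'
    simp only [transpose_add, transpose_mul, transpose_transpose, sub_mul, mul_sub]
    abel
  have hYpsd : ∀ t ∈ Icc (tf - δ) tf, (LQ t - P t).PosSemidef := by
    refine posSemidef_of_lyapunov hAcont' hYsymm hYderiv (by rw [hYtf]; exact .zero) fun t h => ?_
    rw [hYeq t h, neg_neg]
    exact hRpos t h
  exact fun t h => ⟨hPpos t h, hYpsd t h⟩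
end

section
/- (Lemma 3, positive definiteness of the sum) Suppose Q_1(t) + Σ_{i=2}^M Q_i(t) is positive definite for every t ∈ [t_0, t_f] and S_{1f} + Σ_{i=2}^M S_{if} is positive definite. Then for every solution set {S_1, …, S_M} of the AAO coupled Riccati equations on an interval I = [t_f − δ, t_f] ⊆ [t_0, t_f] with 0 < δ ≤ t_f − t_0, the matrix P(t) = Σ_{i=1}^M S_i(t) is positive definite for all t ∈ I. -/
open Matrix Set

/-- A differentiable function on `[a, b]` that is nonpositive at `s < b` and nonnegative on
`(s, b]` cannot have a negative derivative at `s`. -/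
lemma HasDerivWithinAt.nonneg_of_nonneg_right {a b s d : ℝ} {f : ℝ → ℝ} (has : a ≤ s) (hsb : s < b)
    (hf : HasDerivWithinAt f d (Icc a b) s) (hs : f s ≤ 0) (hpos : ∀ t ∈ Ioc s b, 0 ≤ f t) :
    0 ≤ d := by
  have hf' : HasDerivWithinAt f d (Ioc s b) s :=
    hf.mono fun t ht => ⟨has.trans ht.1.le, ht.2⟩
  rw [hasDerivWithinAt_iff_tendsto_slope' (by simp)] at hf'
  have : (nhdsWithin s (Ioc s b)).NeBot := by
    rw [← mem_closure_iff_nhdsWithin_neBot, closure_Ioc hsb.ne]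
    exact left_mem_Icc.2 hsb.le
  refine ge_of_tendsto hf' ?_
  filter_upwards [self_mem_nhdsWithin] with t ht
  rw [slope_def_field]
  exact div_nonneg (by linarith [hpos t ht]) (by linarith [ht.1])

/-- A solution of the Lyapunov differential equation `P' + P B + Bᵀ P + R = 0` with positive
definite source `R` and positive definite terminal value is positive definite. -/
lemma lyapunov_posDef {ι : Type*} [Fintype ι] {a b : ℝ}
    {P P' B R : ℝ → Matrix ι ι ℝ}
    (hsymm : ∀ t ∈ Icc a b, (P t).IsSymm)
    (hderiv : ∀ t ∈ Icc a b, ∀ k l,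
      HasDerivWithinAt (fun s => P s k l) (P' t k l) (Icc a b) t)
    (hP : ∀ t ∈ Icc a b, P' t + P t * B t + (B t)ᵀ * P t + R t = 0)
    (hR : ∀ t ∈ Icc a b, (R t).PosDef) (hb : (P b).PosDef) :
    ∀ t ∈ Icc a b, (P t).PosDef := by
  have hherm : ∀ t ∈ Icc a b, (P t).IsHermitian := fun t ht => by
    rw [IsHermitian, conjTranspose_eq_transpose_of_trivial]
    exact hsymm t ht
  have hcont : ∀ k l, ContinuousOn (fun s => P s k l) (Icc a b) :=
    fun k l t ht => (hderiv t ht k l).continuousWithinAt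
  have hquad : ∀ (w : ι → ℝ), ∀ t ∈ Icc a b,
      HasDerivWithinAt (fun s => w ⬝ᵥ P s *ᵥ w) (w ⬝ᵥ P' t *ᵥ w) (Icc a b) t := by
    intro w t ht
    simp only [dotProduct, mulVec]
    exact HasDerivWithinAt.fun_sum fun k _ => (HasDerivWithinAt.fun_sum fun l _ =>
      (hderiv t ht k l).mul_const (w l)).const_mul (w k)
  let Z : Set (ℝ × (ι → ℝ)) := (Icc a b ×ˢ Metric.sphere 0 1) ∩
    (fun p => p.2 ⬝ᵥ P p.1 *ᵥ p.2) ⁻¹' Iic 0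
  have hZ : IsCompact Z := by
    have hc : IsCompact (Icc a b ×ˢ Metric.sphere (0 : ι → ℝ) 1) :=
      isCompact_Icc.prod (isCompact_sphere _ _)
    refine hc.of_isClosed_subset ?_ inter_subset_left
    refine ContinuousOn.preimage_isClosed_of_isClosed ?_ hc.isClosed isClosed_Iic
    simp only [dotProduct, mulVec]
    have hP' : ∀ k l, ContinuousOn (fun p : ℝ × (ι → ℝ) => P p.1 k l)
        (Icc a b ×ˢ Metric.sphere (0 : ι → ℝ) 1) :=
      fun k l => (hcont k l).comp continuousOn_fst fun p hp => hp.1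
    refine continuousOn_finsetSum _ fun k _ => ContinuousOn.mul (by fun_prop) ?_
    exact continuousOn_finsetSum _ fun l _ => (hP' k l).mul (by fun_prop)
  have hposDef : ∀ t ∈ Icc a b, t ∉ Prod.fst '' Z → (P t).PosDef := by
    intro t ht htZ
    refine PosDef.of_dotProduct_mulVec_pos (hherm t ht) fun w hw => ?_
    rw [star_trivial]
    by_contra! hle
    have hw' : 0 < ‖w‖ := norm_pos_iff.2 hw
    refine htZ ⟨(t, ‖w‖⁻¹ • w), ⟨⟨ht, ?_⟩, ?_⟩, rfl⟩
    · simp [norm_smul, hw'.ne']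
    · simp only [mem_preimage, mem_Iic, mulVec_smul, smul_dotProduct, dotProduct_smul,
        smul_eq_mul]
      have := inv_pos.2 hw'
      exact mul_nonpos_of_nonneg_of_nonpos this.le
        (mul_nonpos_of_nonneg_of_nonpos this.le hle)
  intro t₀ ht₀
  refine hposDef t₀ ht₀ fun hmem => ?_
  obtain ⟨_, ⟨⟨⟨s, v⟩, ⟨⟨hs, hv⟩, hvle⟩, rfl⟩, hmax⟩⟩ :=
    (hZ.image continuous_fst).exists_isGreatest ⟨t₀, hmem⟩
  simp only [mem_preimage, mem_Iic] at hs hv hvle hmax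
  have hv0 : v ≠ 0 := by
    rintro rfl
    simp at hv
  have hsb : s < b := by
    refine lt_of_le_of_ne hs.2 ?_
    rintro rfl
    exact absurd (by simpa using hb.dotProduct_mulVec_pos hv0) hvle.not_gt
  have hpos : ∀ t ∈ Ioc s b, (P t).PosDef := fun t ht =>
    hposDef t ⟨hs.1.trans ht.1.le, ht.2⟩ fun h => ht.1.not_ge (hmax h)
  have hnonneg : ∀ (w : ι → ℝ), ∀ t ∈ Ioc s b, 0 ≤ w ⬝ᵥ P t *ᵥ w := fun w t ht => by
    simpa using (hpos t ht).posSemidef.dotProduct_mulVec_nonneg w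
  have hpsd : (P s).PosSemidef := by
    refine PosSemidef.of_dotProduct_mulVec_nonneg (hherm s hs) fun w => ?_
    rw [star_trivial]
    have : (nhdsWithin s (Ioc s b)).NeBot := by
      rw [← mem_closure_iff_nhdsWithin_neBot, closure_Ioc hsb.ne]
      exact left_mem_Icc.2 hsb.le
    refine ge_of_tendsto ((hquad w s hs).continuousWithinAt.mono fun t ht =>
      ⟨hs.1.trans ht.1.le, ht.2⟩ : ContinuousWithinAt _ (Ioc s b) s) ?_
    filter_upwards [self_mem_nhdsWithin] with t ht using hnonneg w t ht
  have hPv : P s *ᵥ v = 0 := by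
    rw [← hpsd.dotProduct_mulVec_zero_iff, star_trivial]
    exact le_antisymm hvle (by simpa using hpsd.dotProduct_mulVec_nonneg v)
  have hd := (hquad v s hs).nonneg_of_nonneg_right hs.1 hsb hvle (hnonneg v)
  have hvP : v ᵥ* P s = 0 := by
    rw [← mulVec_transpose, hsymm s hs, hPv]
  have hval := congrArg (fun X => v ⬝ᵥ X *ᵥ v) (hP s hs)
  simp only [add_mulVec, dotProduct_add, ← mulVec_mulVec, hPv, mulVec_zero, dotProduct_zero,
    zero_mulVec, dotProduct_mulVec v (P s), hvP, zero_dotProduct, add_zero] at hval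
  have := (hR s hs).dotProduct_mulVec_pos hv0
  rw [star_trivial] at this
  linarith

/-- **Lemma 3 (positive definiteness of the sum).**  If
`Q_1(t) + Σ_{i≥2} Q_i(t) ≻ 0` for all `t` and `S_{1f} + Σ_{i≥2} S_{if} ≻ 0`, then
for every solution set `{S i}` of the AAO coupled Riccati equations on
`I = [t_f − δ, t_f]`, the matrix `P(t) = Σ_i S_i(t)` is positive definite on `I`. -/
theorem aao_sum_posdef {n M : ℕ} [NeZero M] (hn : 1 ≤ n) (hM : 2 ≤ M)
    {t0 tf : ℝ} (ht : t0 < tf)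
    (A : ℝ → Matrix (Fin n) (Fin n) ℝ)
    (H Q : Fin M → ℝ → Matrix (Fin n) (Fin n) ℝ)
    (Sf : Fin M → Matrix (Fin n) (Fin n) ℝ)
    (hAcont : ∀ k l, ContinuousOn (fun t => A t k l) (Icc t0 tf))
    (hHcont : ∀ i k l, ContinuousOn (fun t => H i t k l) (Icc t0 tf))
    (hQcont : ∀ i k l, ContinuousOn (fun t => Q i t k l) (Icc t0 tf))
    (hHpsd : ∀ i, ∀ t ∈ Icc t0 tf, (H i t).PosSemidef)
    (hQ1 : ∀ t ∈ Icc t0 tf, (-(Q 0 t)).PosDef)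
    (hQi : ∀ i : Fin M, i ≠ 0 → ∀ t ∈ Icc t0 tf, (Q i t).PosSemidef)
    (hSf1 : (-(Sf 0)).PosDef)
    (hSfi : ∀ i : Fin M, i ≠ 0 → (Sf i).PosSemidef)
    {δ : ℝ} (hδ0 : 0 < δ) (hδ : δ ≤ tf - t0)
    (S S' : Fin M → ℝ → Matrix (Fin n) (Fin n) ℝ)
    (hSsym : ∀ i, ∀ t ∈ Icc (tf - δ) tf, (S i t).IsSymm)
    (hSderiv : ∀ i, ∀ t ∈ Icc (tf - δ) tf, ∀ k l,
      HasDerivWithinAt (fun s => S i s k l) (S' i t k l) (Icc (tf - δ) tf) t)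
    (hS'cont : ∀ i k l, ContinuousOn (fun t => S' i t k l) (Icc (tf - δ) tf))
    (hRic : ∀ i, ∀ t ∈ Icc (tf - δ) tf,
      S' i t + S i t * A t + (A t)ᵀ * S i t + Q i t + S i t * H i t * S i t
        - ∑ j, (S i t * H j t * S j t + S j t * H j t * S i t) = 0)
    (hterm : ∀ i, S i tf = Sf i)
    (hQsum : ∀ t ∈ Icc t0 tf,
      (Q 0 t + ∑ i ∈ Finset.univ.erase 0, Q i t).PosDef)
    (hSfsum : (Sf 0 + ∑ i ∈ Finset.univ.erase 0, Sf i).PosDef) :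
    ∀ t ∈ Icc (tf - δ) tf, (∑ i, S i t).PosDef := by
  have hsub : Icc (tf - δ) tf ⊆ Icc t0 tf := Icc_subset_Icc_left (by linarith)
  have hSherm : ∀ i, ∀ t ∈ Icc (tf - δ) tf, (S i t)ᴴ = S i t := fun i t h => by
    rw [conjTranspose_eq_transpose_of_trivial]
    exact hSsym i t h
  refine lyapunov_posDef (P' := fun t => ∑ i, S' i t)
    (B := fun t => A t - ∑ j, H j t * S j t)
    (R := fun t => ∑ i, Q i t + ∑ i, S i t * H i t * S i t) ?_ ?_ ?_ ?_ ?_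
  · intro t h
    rw [IsSymm, transpose_sum]
    exact Finset.sum_congr rfl fun i _ => hSsym i t h
  · intro t h k l
    simp only [Matrix.sum_apply]
    exact HasDerivWithinAt.fun_sum fun i _ => hSderiv i t h k l
  · intro t h
    have hHt : ∀ j, (H j t)ᵀ = H j t := fun j => by
      rw [← conjTranspose_eq_transpose_of_trivial]
      exact (hHpsd j t (hsub h)).1
    have hSt : ∀ j, (S j t)ᵀ = S j t := fun j => hSsym j t h
    have hsum := Finset.sum_congr (rfl : Finset.univ = Finset.univ) fun i _ => hRic i t h
    have hleft : ∑ i, ∑ j, S i t * H j t * S j t = (∑ i, S i t) * ∑ j, H j t * S j t := by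
      simp only [Finset.sum_mul_sum, mul_assoc]
    simp only [Finset.sum_add_distrib, Finset.sum_sub_distrib, Finset.sum_const_zero, hleft,
      ← Finset.sum_mul, ← Finset.mul_sum] at hsum
    simp only [transpose_sub, transpose_sum, transpose_mul, hHt, hSt, mul_sub, sub_mul]
    rw [← hsum]
    abel
  · intro t h
    rw [← Finset.add_sum_erase _ _ (Finset.mem_univ 0)]
    refine (hQsum t (hsub h)).add_posSemidef (posSemidef_sum _ fun i _ => ?_)
    simpa only [hSherm i t h] using (hHpsd i t (hsub h)).mul_mul_conjTranspose_same (S i t)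
  · simp only [hterm]
    rwa [← Finset.add_sum_erase _ _ (Finset.mem_univ 0)]
end

section
/- (Lyapunov derivative identity, equation (26)) Let {S_1, …, S_M} be a solution set of the AAO coupled Riccati equations on [t_0, t_f], define P(t) = Σ_{i=1}^M S_i(t) and Ā(t) = A(t) − Σ_{j=1}^M H_j(t) S_j(t), and let x : [t_0, t_f] → ℝⁿ be differentiable with ẋ(t) = Ā(t) x(t). Then the function V(t) = x(t)ᵀ P(t) x(t) satisfies, for all t ∈ [t_0, t_f], V̇(t) = − x(t)ᵀ ( Σ_{i=1}^M ( Q_i(t) + S_i(t) H_i(t) S_i(t) ) ) x(t). -/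
open Matrix Set

/-- Product rule for a time-varying quadratic form, with entrywise derivatives. -/
theorem hasDerivWithinAt_dotProduct_mulVec {ι : Type*} [Fintype ι] {s : Set ℝ} {t : ℝ}
    {x : ℝ → ι → ℝ} {x' : ι → ℝ} {P : ℝ → Matrix ι ι ℝ} {P' : Matrix ι ι ℝ}
    (hx : ∀ k, HasDerivWithinAt (fun r => x r k) (x' k) s t)
    (hP : ∀ k l, HasDerivWithinAt (fun r => P r k l) (P' k l) s t) :
    HasDerivWithinAt (fun r => x r ⬝ᵥ P r *ᵥ x r)
      (x' ⬝ᵥ P t *ᵥ x t + x t ⬝ᵥ (P' *ᵥ x t + P t *ᵥ x')) s t := by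
  have hPx : ∀ k, HasDerivWithinAt (fun r => (P r *ᵥ x r) k)
      ((P' *ᵥ x t + P t *ᵥ x') k) s t := fun k => by
    simpa only [mulVec, dotProduct, Pi.add_apply, Finset.sum_add_distrib] using
      HasDerivWithinAt.fun_sum (u := Finset.univ) fun l _ => (hP k l).fun_mul (hx l)
  simpa only [dotProduct, Finset.sum_add_distrib] using
    HasDerivWithinAt.fun_sum (u := Finset.univ) fun k _ => (hx k).fun_mul (hPx k)

/-- Summing the coupled Riccati equations gives a Lyapunov equation for `∑ i, S i`
along the closed-loop matrix. -/
theorem lyapunov_eq_of_coupled_riccati {ι κ R : Type*} [Fintype ι] [Fintype κ] [CommRing R]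
    {A : Matrix ι ι R} {H Q S S' : κ → Matrix ι ι R}
    (hH : ∀ i, (H i).IsSymm) (hS : ∀ i, (S i).IsSymm)
    (hRic : ∀ i, S' i + S i * A + Aᵀ * S i + Q i + S i * H i * S i
        - ∑ j, (S i * H j * S j + S j * H j * S i) = 0) :
    (A - ∑ j, H j * S j)ᵀ * (∑ i, S i) + ∑ i, S' i + (∑ i, S i) * (A - ∑ j, H j * S j)
      = -∑ i, (Q i + S i * H i * S i) := by
  have hT : (∑ j, H j * S j)ᵀ = ∑ j, S j * H j := by
    simp only [transpose_sum, transpose_mul, (hH _).eq, (hS _).eq]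
  have hsum := Finset.sum_congr (rfl : Finset.univ = Finset.univ) fun i _ => hRic i
  simp only [Finset.sum_add_distrib, Finset.sum_sub_distrib, Finset.sum_const_zero,
    ← Finset.sum_mul, ← Finset.mul_sum, mul_assoc] at hsum
  simp only [← mul_assoc, ← Finset.sum_mul, ← Finset.mul_sum] at hsum
  rw [transpose_sub, hT, sub_mul, mul_sub, Finset.sum_add_distrib, ← sub_eq_zero, ← hsum]
  simp only [mul_assoc]
  abel

/-- **Lyapunov derivative identity (equation (26)).**  For a solution set
`{S i}` of the AAO coupled Riccati equations on `[t_0, t_f]`, with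
`P(t) = Σ_i S_i(t)`, `Ā(t) = A(t) − Σ_j H_j(t) S_j(t)`, and a trajectory `x`
solving `ẋ = Ā x`, the function `V(t) = x(t)ᵀ P(t) x(t)` satisfies
`V̇(t) = −x(t)ᵀ (Σ_i (Q_i(t) + S_i(t) H_i(t) S_i(t))) x(t)`. -/
theorem aao_lyapunov_derivative {n M : ℕ} [NeZero M] (hn : 1 ≤ n) (hM : 2 ≤ M)
    {t0 tf : ℝ} (ht : t0 < tf)
    (A : ℝ → Matrix (Fin n) (Fin n) ℝ)
    (H Q : Fin M → ℝ → Matrix (Fin n) (Fin n) ℝ)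
    (Sf : Fin M → Matrix (Fin n) (Fin n) ℝ)
    (hAcont : ∀ k l, ContinuousOn (fun t => A t k l) (Icc t0 tf))
    (hHcont : ∀ i k l, ContinuousOn (fun t => H i t k l) (Icc t0 tf))
    (hQcont : ∀ i k l, ContinuousOn (fun t => Q i t k l) (Icc t0 tf))
    (hHpsd : ∀ i, ∀ t ∈ Icc t0 tf, (H i t).PosSemidef)
    (hQ1 : ∀ t ∈ Icc t0 tf, (-(Q 0 t)).PosDef)
    (hQi : ∀ i : Fin M, i ≠ 0 → ∀ t ∈ Icc t0 tf, (Q i t).PosSemidef)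
    (hSf1 : (-(Sf 0)).PosDef)
    (hSfi : ∀ i : Fin M, i ≠ 0 → (Sf i).PosSemidef)
    (S S' : Fin M → ℝ → Matrix (Fin n) (Fin n) ℝ)
    (hSsym : ∀ i, ∀ t ∈ Icc t0 tf, (S i t).IsSymm)
    (hSderiv : ∀ i, ∀ t ∈ Icc t0 tf, ∀ k l,
      HasDerivWithinAt (fun s => S i s k l) (S' i t k l) (Icc t0 tf) t)
    (hS'cont : ∀ i k l, ContinuousOn (fun t => S' i t k l) (Icc t0 tf))
    (hRic : ∀ i, ∀ t ∈ Icc t0 tf,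
      S' i t + S i t * A t + (A t)ᵀ * S i t + Q i t + S i t * H i t * S i t
        - ∑ j, (S i t * H j t * S j t + S j t * H j t * S i t) = 0)
    (hterm : ∀ i, S i tf = Sf i)
    (x : ℝ → Fin n → ℝ)
    (hx : ∀ t ∈ Icc t0 tf, ∀ k,
      HasDerivWithinAt (fun s => x s k)
        (((A t - ∑ j, H j t * S j t).mulVec (x t)) k) (Icc t0 tf) t) :
    ∀ t ∈ Icc t0 tf,
      HasDerivWithinAt (fun s => x s ⬝ᵥ (∑ i, S i s).mulVec (x s))
        (-(x t ⬝ᵥ (∑ i, (Q i t + S i t * H i t * S i t)).mulVec (x t)))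
        (Icc t0 tf) t := by
  intro t ht
  have hV := hasDerivWithinAt_dotProduct_mulVec (P := fun s => ∑ i, S i s) (P' := ∑ i, S' i t)
    (hx t ht) fun k l => by
      simpa only [Matrix.sum_apply] using
        HasDerivWithinAt.fun_sum (u := Finset.univ) fun i _ => hSderiv i t ht k l
  refine hV.congr_deriv ?_
  have hsymm : ∀ i, (H i t).IsSymm := fun i => by
    simpa only [IsSymm, IsHermitian, conjTranspose_eq_transpose_of_trivial] using
      (hHpsd i t ht).isHermitian
  rw [← dotProduct_neg, ← neg_mulVec,
    ← lyapunov_eq_of_coupled_riccati hsymm (fun i => hSsym i t ht) (fun i => hRic i t ht)]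
  simp only [add_mulVec, dotProduct_add, ← mulVec_mulVec, add_assoc]
  rw [dotProduct_mulVec (x t) (A t - ∑ j, H j t * S j t)ᵀ, vecMul_transpose]
end
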